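/- Let H be a weighted r-uniform hypergraph on a finite set V with weights d : H → (0,∞), let p ∈ (0,1), let η ≥ 0, let R be the p-random subset of V, and let Y = (Y_v)_{v∈V} be the indicator vector of R conditioned on the event e(H[R]) ≤ η·p^r·e(H). Then, for every W ⊆ V and every A ⊆ V \ W, E[∏_{a∈A} Y_a | (Y_w)_{w∈W}] ≤ p^{|A|} almost surely. -/

import Mathlib

open Classical

noncomputable section

/-- The probability of the configuration `ω ⊆ V` under the product measure in which
each vertex `v` is retained independently with probability `q v`. -/
def pw {V : Type*} [Fintype V] [DecidableEq V] (q : V → ℝ) (ω : Finset V) : ℝ :=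
  (∏ v ∈ ω, q v) * ∏ v ∈ ωᶜ, (1 - q v)

/-- The relative entropy `i_p(q) = D_KL(Ber(q) ‖ Ber(p))`.  (In Lean `Real.log 0 = 0`,
which implements the convention `0 · log 0 = 0`.) -/
def ip (p q : ℝ) : ℝ :=
  q * Real.log (q / p) + (1 - q) * Real.log ((1 - q) / (1 - p))

/-- `e(H[ω])`: the total weight of the edges of the weighted hypergraph `(H, d)`
induced by the set `ω`. -/
def eInd {V : Type*} [DecidableEq V] (H : Finset (Finset V)) (d : Finset V → ℝ)
    (ω : Finset V) : ℝ :=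
  ∑ A ∈ H, if A ⊆ ω then d A else 0

/-- `e(H)`: the total weight of the weighted hypergraph `(H, d)`. -/
def eTot {V : Type*} (H : Finset (Finset V)) (d : Finset V → ℝ) : ℝ :=
  ∑ A ∈ H, d A

/-- `deg_H B`: the total weight of the edges of `(H, d)` containing `B`. -/
def degH {V : Type*} [DecidableEq V] (H : Finset (Finset V)) (d : Finset V → ℝ)
    (B : Finset V) : ℝ :=
  ∑ A ∈ H, if B ⊆ A then d A else 0

/-- The probability of the event `P` for the indicator vector `Y` of the `p`-random
subset `R` of `V` conditioned on the lower-tail event `e(H[R]) ≤ η p^r e(H)`. -/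
def nuPr {V : Type*} [Fintype V] [DecidableEq V] (H : Finset (Finset V))
    (d : Finset V → ℝ) (r : ℕ) (p η : ℝ) (P : Finset V → Prop) : ℝ :=
  (∑ ω : Finset V,
      if P ω ∧ eInd H d ω ≤ η * p ^ r * eTot H d then pw (fun _ => p) ω else 0) /
    ∑ ω : Finset V,
      if eInd H d ω ≤ η * p ^ r * eTot H d then pw (fun _ => p) ω else 0

/-- The conditional expectation `E_W[Y_B] = E[∏_{b ∈ B} Y_b ∣ (Y_w)_{w ∈ W} = 𝟙_s]`
for the conditioned indicator vector `Y`. -/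
def condE {V : Type*} [Fintype V] [DecidableEq V] (H : Finset (Finset V))
    (d : Finset V → ℝ) (r : ℕ) (p η : ℝ) (W s B : Finset V) : ℝ :=
  nuPr H d r p η (fun ω => B ⊆ ω ∧ ω ∩ W = s) / nuPr H d r p η (fun ω => ω ∩ W = s)

/-- `D_W(B, b) = E_W[Y_B] − E_W[Y_{B∖{b}}] · E_W[Y_b]`, evaluated at
`(Y_w)_{w ∈ W} = 𝟙_s`. -/
def DW {V : Type*} [Fintype V] [DecidableEq V] (H : Finset (Finset V))
    (d : Finset V → ℝ) (r : ℕ) (p η : ℝ) (W s B : Finset V) (b : V) : ℝ :=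
  condE H d r p η W s B - condE H d r p η W s (B.erase b) * condE H d r p η W s {b}

/-- The quantity `𝓔(W)` from equation `eq:Err-W-def`:
`E[ ∑_{A ∈ H−W} ∑_{B ⊆ A, |B| ≥ 2} ∑_{b ∈ B} d_A D_W(B,b)² / (C(r,|B|)·|B|·p^{2|B|}) ]`,
where the expectation averages over the values `𝟙_s` of `(Y_w)_{w ∈ W}`. -/
def errW {V : Type*} [Fintype V] [DecidableEq V] (H : Finset (Finset V))
    (d : Finset V → ℝ) (r : ℕ) (p η : ℝ) (W : Finset V) : ℝ :=
  ∑ s ∈ W.powerset, nuPr H d r p η (fun ω => ω ∩ W = s) *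
    ∑ A ∈ H.filter (fun A => Disjoint A W),
      ∑ B ∈ A.powerset.filter (fun B => 2 ≤ B.card), ∑ b ∈ B,
        d A * (DW H d r p η W s B b) ^ 2 /
          ((r.choose B.card : ℝ) * (B.card : ℝ) * p ^ (2 * B.card))

/-- The quantity `H(W) = ∑_{v ∈ V∖W} I_p(Y_v ∣ (Y_w)_{w ∈ W})`, written out via
`I_p(Y_v ∣ S) = ∑_s Pr(S = 𝟙_s) · i_p(Pr(Y_v = 1 ∣ S = 𝟙_s))`. -/
def HW {V : Type*} [Fintype V] [DecidableEq V] (H : Finset (Finset V))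
    (d : Finset V → ℝ) (r : ℕ) (p η : ℝ) (W : Finset V) : ℝ :=
  ∑ v ∈ Wᶜ, ∑ s ∈ W.powerset,
    nuPr H d r p η (fun ω => ω ∩ W = s) * ip p (condE H d r p η W s {v})

theorem eInd_mono {V : Type*} [DecidableEq V] {H : Finset (Finset V)} {d : Finset V → ℝ}
    (hd : ∀ A ∈ H, 0 ≤ d A)
    {ω ω' : Finset V} (h : ω ⊆ ω') : eInd H d ω ≤ eInd H d ω' := by
  refine Finset.sum_le_sum fun A hA => ?_
  by_cases h1 : A ⊆ ω
  · rw [if_pos h1, if_pos (h1.trans h)]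
  · rw [if_neg h1]
    split_ifs
    exacts [hd A hA, le_rfl]

section ProductWeight

variable {V : Type*} [Fintype V] [DecidableEq V]

theorem pw_nonneg {q : V → ℝ} (h0 : ∀ v, 0 ≤ q v) (h1 : ∀ v, q v ≤ 1) (ω : Finset V) :
    0 ≤ pw q ω :=
  mul_nonneg (Finset.prod_nonneg fun v _ => h0 v)
    (Finset.prod_nonneg fun v _ => sub_nonneg.2 (h1 v))

theorem one_sub_mul_pw_eq_mul_pw_erase (q : V → ℝ) {a : V} {ω : Finset V} (ha : a ∈ ω) :
    (1 - q a) * pw q ω = q a * pw q (ω.erase a) := by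
  have hc : (ω.erase a)ᶜ = insert a ωᶜ := Finset.compl_erase
  have ha' : a ∉ ωᶜ := by simpa using ha
  rw [pw, pw, hc, Finset.prod_insert ha', ← Finset.mul_prod_erase ω q ha]
  ring

/-- If an event is closed under removing `a`, then `a` is present together with the event
with probability at most `q a` times the probability of the event. -/
theorem sum_pw_mem_and_le {q : V → ℝ} (h0 : ∀ v, 0 ≤ q v) (h1 : ∀ v, q v ≤ 1) (a : V)
    (P : Finset V → Prop) (hP : ∀ ω, P ω → P (ω.erase a)) :
    ∑ ω : Finset V, (if a ∈ ω ∧ P ω then pw q ω else 0) ≤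
      q a * ∑ ω : Finset V, if P ω then pw q ω else 0 := by
  have hsplit : ∑ ω : Finset V, (if P ω then pw q ω else 0) =
      ∑ ω : Finset V, (if a ∈ ω ∧ P ω then pw q ω else 0) +
        ∑ ω : Finset V, (if a ∉ ω ∧ P ω then pw q ω else 0) := by
    rw [← Finset.sum_add_distrib]
    refine Finset.sum_congr rfl fun ω _ => ?_
    by_cases ha : a ∈ ω <;> simp [ha]
  have herase : (1 - q a) * ∑ ω : Finset V, (if a ∈ ω ∧ P ω then pw q ω else 0) ≤
      q a * ∑ ω : Finset V, (if a ∉ ω ∧ P ω then pw q ω else 0) := by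
    rw [← Finset.sum_filter, ← Finset.sum_filter, Finset.mul_sum, Finset.mul_sum]
    have hinj : Set.InjOn (fun ω : Finset V => ω.erase a)
        (Finset.univ.filter fun ω : Finset V => a ∈ ω ∧ P ω) := by
      intro x hx y hy hxy
      have hx' : a ∈ x := (Finset.mem_filter.1 hx).2.1
      have hy' : a ∈ y := (Finset.mem_filter.1 hy).2.1
      rw [← Finset.insert_erase hx', ← Finset.insert_erase hy']
      exact congrArg (insert a) hxy
    calc ∑ ω ∈ Finset.univ.filter (fun ω : Finset V => a ∈ ω ∧ P ω), (1 - q a) * pw q ω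
        = ∑ ω ∈ Finset.univ.filter (fun ω : Finset V => a ∈ ω ∧ P ω),
            q a * pw q (ω.erase a) :=
          Finset.sum_congr rfl fun ω hω =>
            one_sub_mul_pw_eq_mul_pw_erase q (Finset.mem_filter.1 hω).2.1
      _ = ∑ ω ∈ (Finset.univ.filter fun ω : Finset V => a ∈ ω ∧ P ω).image
            (fun ω => ω.erase a), q a * pw q ω := by
          rw [Finset.sum_image hinj]
      _ ≤ ∑ ω ∈ Finset.univ.filter (fun ω : Finset V => a ∉ ω ∧ P ω), q a * pw q ω := by
          refine Finset.sum_le_sum_of_subset_of_nonneg ?_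
            fun ω _ _ => mul_nonneg (h0 a) (pw_nonneg h0 h1 ω)
          intro ω hω
          obtain ⟨ω', hω', rfl⟩ := Finset.mem_image.1 hω
          exact Finset.mem_filter.2 ⟨Finset.mem_univ _, Finset.notMem_erase a ω',
            hP ω' (Finset.mem_filter.1 hω').2.2⟩
  rw [hsplit]
  linarith

theorem sum_pw_subset_and_le {q : V → ℝ} (h0 : ∀ v, 0 ≤ q v) (h1 : ∀ v, q v ≤ 1)
    (A : Finset V) (P : Finset V → Prop) (hP : ∀ a ∈ A, ∀ ω, P ω → P (ω.erase a)) :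
    ∑ ω : Finset V, (if A ⊆ ω ∧ P ω then pw q ω else 0) ≤
      (∏ a ∈ A, q a) * ∑ ω : Finset V, if P ω then pw q ω else 0 := by
  induction A using Finset.induction_on with
  | empty => simp
  | insert a A ha ih =>
    have hstep := sum_pw_mem_and_le h0 h1 a (fun ω => A ⊆ ω ∧ P ω) fun ω hω =>
      ⟨Finset.subset_erase.2 ⟨hω.1, ha⟩, hP a (Finset.mem_insert_self a A) ω hω.2⟩
    have ih := mul_le_mul_of_nonneg_left
      (ih fun b hb => hP b (Finset.mem_insert_of_mem hb)) (h0 a)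
    rw [Finset.prod_insert ha, mul_assoc]
    simp only [Finset.insert_subset_iff, and_assoc]
    refine le_trans ?_ (hstep.trans (le_of_eq_of_le ?_ ih))
    · exact le_of_eq (by congr!)
    · congr!

end ProductWeight

/-- Claim `claim:FKG`: if `Y` is the indicator vector of the `p`-random subset `R` of `V`
conditioned on the lower-tail event `e(H[R]) ≤ η p^r e(H)`, then for every `W ⊆ V`, every
`A ⊆ V ∖ W`, and (almost) every value `𝟙_s` of `(Y_w)_{w ∈ W}`,
`E[∏_{a ∈ A} Y_a ∣ (Y_w)_{w ∈ W} = 𝟙_s] ≤ p^{|A|}`. -/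
theorem harris_conditional_bound {V : Type*} [Fintype V] [DecidableEq V] (r : ℕ)
    (H : Finset (Finset V)) (d : Finset V → ℝ)
    (hunif : ∀ A ∈ H, A.card = r) (hd : ∀ A ∈ H, 0 < d A)
    (p η : ℝ) (hp0 : 0 < p) (hp1 : p < 1) (hη : 0 ≤ η)
    (W A : Finset V) (hA : A ⊆ Wᶜ) (s : Finset V) (hs : s ⊆ W)
    (hpos : nuPr H d r p η (fun ω => ω ∩ W = s) ≠ 0) :
    nuPr H d r p η (fun ω => A ⊆ ω ∧ ω ∩ W = s) /
        nuPr H d r p η (fun ω => ω ∩ W = s) ≤ p ^ A.card := by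
  have hZ : (∑ ω : Finset V,
      if eInd H d ω ≤ η * p ^ r * eTot H d then pw (fun _ => p) ω else 0) ≠ 0 :=
    fun h => hpos (by rw [nuPr, h, div_zero])
  have hle := sum_pw_subset_and_le (q := fun _ : V => p) (fun _ => hp0.le) (fun _ => hp1.le) A
    (fun ω => ω ∩ W = s ∧ eInd H d ω ≤ η * p ^ r * eTot H d) fun a ha ω hω => by
      have haW : a ∉ W := Finset.mem_compl.1 (hA ha)
      refine ⟨?_, (eInd_mono (fun B hB => (hd B hB).le) (Finset.erase_subset a ω)).trans hω.2⟩
      rw [Finset.erase_inter, Finset.erase_eq_of_notMem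
        (fun h => haW (Finset.mem_inter.1 h).2), hω.1]
  rw [nuPr, nuPr, div_div_div_cancel_right₀ hZ]
  refine div_le_of_le_mul₀ (Finset.sum_nonneg fun ω _ => ?_) (pow_nonneg hp0.le _) ?_
  · split_ifs
    exacts [pw_nonneg (fun _ => hp0.le) (fun _ => hp1.le) ω, le_rfl]
  · simp only [and_assoc]
    rw [Finset.prod_const] at hle
    refine le_trans (le_of_eq ?_) (hle.trans (le_of_eq ?_)) <;> congr!

end
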